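/- With p, Φ, m as above, define Q(y,F) = m(y)⁻¹ ∫_{Φ⁻¹(y)∩F} p(x)/J_NΦ(x) dH^{M−N}(x) for 0 < m(y) < ∞ (and Q(y,·) = δ_{x*} otherwise). Then P(x,F) = Q(Φ(x),F) is a regular conditional probability for P(dx) = p(x)λᴹ(dx) given the σ-algebra Φ⁻¹(B): for every C in Φ⁻¹(B) and every Lebesgue measurable F, P(C ∩ F) = ∫_C P(x,F) P(dx). -/

import Mathlib

open MeasureTheory Matrix

/-- The matrix of a linear map between Euclidean spaces in the standard bases. -/
noncomputable def euclideanMatrix {M N : ℕ}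
    (L : EuclideanSpace ℝ (Fin M) →L[ℝ] EuclideanSpace ℝ (Fin N)) :
    Matrix (Fin N) (Fin M) ℝ :=
  Matrix.of fun i j => L (EuclideanSpace.single j 1) i

/-- The co-area factor `√(det (L Lᵀ))` of a linear map between Euclidean spaces. -/
noncomputable def coareaFactor {M N : ℕ}
    (L : EuclideanSpace ℝ (Fin M) →L[ℝ] EuclideanSpace ℝ (Fin N)) : ℝ :=
  Real.sqrt (euclideanMatrix L * (euclideanMatrix L).transpose).det

theorem continuous_euclideanMatrix {M N : ℕ} :
    Continuous (euclideanMatrix (M := M) (N := N)) := by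
  refine continuous_matrix fun i j => ?_
  simp only [euclideanMatrix, Matrix.of_apply]
  fun_prop

theorem continuous_coareaFactor {M N : ℕ} : Continuous (coareaFactor (M := M) (N := N)) := by
  have h := continuous_euclideanMatrix (M := M) (N := N)
  exact Real.continuous_sqrt.comp (h.matrix_mul h.matrix_transpose).matrix_det

theorem apply_eq_sum_euclideanMatrix {M N : ℕ}
    (L : EuclideanSpace ℝ (Fin M) →L[ℝ] EuclideanSpace ℝ (Fin N)) (x : EuclideanSpace ℝ (Fin M))
    (i : Fin N) : L x i = (euclideanMatrix L *ᵥ x.ofLp) i := by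
  have hx : x = ∑ j, x j • EuclideanSpace.single j (1 : ℝ) := by
    simpa using ((EuclideanSpace.basisFun (Fin M) ℝ).sum_repr x).symm
  conv_lhs => rw [hx]
  simp [Matrix.mulVec, dotProduct, euclideanMatrix, mul_comm]

theorem exists_rightInverse_of_coareaFactor_pos {M N : ℕ}
    {L : EuclideanSpace ℝ (Fin M) →L[ℝ] EuclideanSpace ℝ (Fin N)} (hL : 0 < coareaFactor L) :
    ∃ R : EuclideanSpace ℝ (Fin N) →L[ℝ] EuclideanSpace ℝ (Fin M), ∀ y, L (R y) = y := by
  have hdet : IsUnit (euclideanMatrix L * (euclideanMatrix L).transpose).det :=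
    (Real.sqrt_pos.1 hL).ne'.isUnit
  have hsurj : Function.Surjective
      (L : EuclideanSpace ℝ (Fin M) →ₗ[ℝ] EuclideanSpace ℝ (Fin N)) := by
    intro y
    refine ⟨WithLp.toLp 2 ((euclideanMatrix L).transpose *ᵥ
      ((euclideanMatrix L * (euclideanMatrix L).transpose)⁻¹ *ᵥ y.ofLp)), ?_⟩
    ext i
    rw [ContinuousLinearMap.coe_coe, apply_eq_sum_euclideanMatrix]
    simp [Matrix.mul_nonsing_inv _ hdet, ← Matrix.mul_assoc]
  obtain ⟨R, hR⟩ := LinearMap.exists_rightInverse_of_surjective _ (LinearMap.range_eq_top.2 hsurj)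
  exact ⟨R.toContinuousLinearMap, fun y => LinearMap.congr_fun hR y⟩

/-- Concatenation of coordinates, as a linear equivalence. -/
noncomputable def euclideanAppend (N k : ℕ) :
    (EuclideanSpace ℝ (Fin N) × EuclideanSpace ℝ (Fin k)) ≃L[ℝ] EuclideanSpace ℝ (Fin (N + k)) :=
  LinearEquiv.toContinuousLinearEquiv
    { toFun := fun z => WithLp.toLp 2 fun i => Sum.elim z.1 z.2 (finSumFinEquiv.symm i)
      map_add' := fun z w => by
        ext i
        obtain ⟨s, rfl⟩ := finSumFinEquiv.surjective i
        cases s <;> simp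
      map_smul' := fun c z => by
        ext i
        obtain ⟨s, rfl⟩ := finSumFinEquiv.surjective i
        cases s <;> simp
      invFun := fun x => (WithLp.toLp 2 fun i => x (finSumFinEquiv (Sum.inl i)),
        WithLp.toLp 2 fun i => x (finSumFinEquiv (Sum.inr i)))
      left_inv := fun z => by ext i <;> simp
      right_inv := fun x => by
        ext i
        obtain ⟨s, rfl⟩ := finSumFinEquiv.surjective i
        cases s <;> simp }

theorem euclideanAppend_apply {N k : ℕ}
    (z : EuclideanSpace ℝ (Fin N) × EuclideanSpace ℝ (Fin k)) (i : Fin (N + k)) :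
    euclideanAppend N k z i = Sum.elim z.1.ofLp z.2.ofLp (finSumFinEquiv.symm i) := rfl

/-- The square linear map whose coordinates are those of `L` followed by those of `T`. -/
noncomputable def appendMap {M N k : ℕ}
    (L : EuclideanSpace ℝ (Fin M) →L[ℝ] EuclideanSpace ℝ (Fin N))
    (T : EuclideanSpace ℝ (Fin M) →L[ℝ] EuclideanSpace ℝ (Fin k)) :
    EuclideanSpace ℝ (Fin M) →L[ℝ] EuclideanSpace ℝ (Fin (N + k)) :=
  (euclideanAppend N k : _ →L[ℝ] _).comp (L.prod T)

theorem abs_det_appendMap {N k : ℕ}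
    {L : EuclideanSpace ℝ (Fin (N + k)) →L[ℝ] EuclideanSpace ℝ (Fin N)}
    {T : EuclideanSpace ℝ (Fin (N + k)) →L[ℝ] EuclideanSpace ℝ (Fin k)}
    (hT : euclideanMatrix T * (euclideanMatrix T).transpose = 1)
    (hLT : euclideanMatrix L * (euclideanMatrix T).transpose = 0) :
    |(appendMap L T).det| = coareaFactor L := by
  have hmat : LinearMap.toMatrix (EuclideanSpace.basisFun (Fin (N + k)) ℝ).toBasis
      (EuclideanSpace.basisFun (Fin (N + k)) ℝ).toBasis
      (appendMap L T : EuclideanSpace ℝ (Fin (N + k)) →ₗ[ℝ] _) =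
      (Matrix.fromRows (euclideanMatrix L) (euclideanMatrix T)).submatrix
        finSumFinEquiv.symm id := by
    ext i j
    obtain ⟨s, rfl⟩ := finSumFinEquiv.surjective i
    cases s <;>
    simp [LinearMap.toMatrix_apply, appendMap, euclideanAppend_apply, euclideanMatrix]
  have hdet : (appendMap L T).det = ((Matrix.fromRows (euclideanMatrix L)
      (euclideanMatrix T)).submatrix finSumFinEquiv.symm id).det := by
    rw [← hmat, LinearMap.det_toMatrix, ContinuousLinearMap.det]
  have hsq : (appendMap L T).det ^ 2 =
      (euclideanMatrix L * (euclideanMatrix L).transpose).det := by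
    rw [sq, hdet]
    nth_rewrite 2 [← Matrix.det_transpose]
    rw [← Matrix.det_mul, Matrix.transpose_submatrix,
      ← Matrix.submatrix_mul _ _ _ id _ Function.bijective_id]
    rw [Matrix.det_submatrix_equiv_self, Matrix.transpose_fromRows, Matrix.fromRows_mul_fromCols,
      hLT, hT, Matrix.det_fromBlocks_zero₁₂, Matrix.det_one, mul_one]
  rw [coareaFactor, ← hsq, Real.sqrt_sq_eq_abs]

/-- A co-isometry onto the kernel of `L`, in orthonormal coordinates. -/
theorem exists_kernel_coordinates {N k : ℕ}
    {L : EuclideanSpace ℝ (Fin (N + k)) →L[ℝ] EuclideanSpace ℝ (Fin N)}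
    (hL : 0 < coareaFactor L) :
    ∃ (T : EuclideanSpace ℝ (Fin (N + k)) →L[ℝ] EuclideanSpace ℝ (Fin k)) (C : ℝ), 0 < C ∧
      (∀ v, ‖T v‖ ≤ ‖v‖) ∧ (∀ v, ‖v‖ ≤ ‖T v‖ + C * ‖L v‖) ∧
      |(appendMap L T).det| = coareaFactor L := by
  obtain ⟨R, hR⟩ := exists_rightInverse_of_coareaFactor_pos hL
  let K : Submodule ℝ (EuclideanSpace ℝ (Fin (N + k))) :=
    LinearMap.ker (L : EuclideanSpace ℝ (Fin (N + k)) →ₗ[ℝ] EuclideanSpace ℝ (Fin N))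
  have hK : Module.finrank ℝ K = k := by
    have h := LinearMap.finrank_range_add_finrank_ker
      (L : EuclideanSpace ℝ (Fin (N + k)) →ₗ[ℝ] EuclideanSpace ℝ (Fin N))
    rw [LinearMap.range_eq_top.2 fun y => ⟨R y, hR y⟩] at h
    simp only [finrank_top, finrank_euclideanSpace, Fintype.card_fin] at h
    exact Nat.add_left_cancel h
  let b : OrthonormalBasis (Fin k) ℝ K :=
    (stdOrthonormalBasis ℝ K).reindex (finCongr hK)
  let T : EuclideanSpace ℝ (Fin (N + k)) →L[ℝ] EuclideanSpace ℝ (Fin k) :=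
    (b.repr.toContinuousLinearEquiv : K →L[ℝ] EuclideanSpace ℝ (Fin k)).comp
      K.orthogonalProjectionOnto
  have hTle : ∀ v, ‖T v‖ ≤ ‖v‖ := fun v => by
    simpa [T] using K.norm_orthogonalProjectionOnto_apply_le v
  have hTeq : ∀ v ∈ K, ‖T v‖ = ‖v‖ := fun v hv => by
    have := Submodule.orthogonalProjectionOnto_mem_subspace_eq_self (⟨v, hv⟩ : K)
    simp only [T, ContinuousLinearMap.comp_apply, ContinuousLinearEquiv.coe_coe,
      LinearIsometryEquiv.coe_toContinuousLinearEquiv, LinearIsometryEquiv.norm_map]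
    rw [this]
    rfl
  have hTmat : ∀ i j, euclideanMatrix T i j = (b i : EuclideanSpace ℝ (Fin (N + k))) j := by
    intro i j
    simp only [euclideanMatrix, Matrix.of_apply, T, ContinuousLinearMap.comp_apply,
      ContinuousLinearEquiv.coe_coe, LinearIsometryEquiv.coe_toContinuousLinearEquiv,
      OrthonormalBasis.repr_apply_apply]
    rw [Submodule.inner_orthogonalProjectionOnto_eq_of_mem_left]
    simp [EuclideanSpace.inner_single_right]
  refine ⟨T, 2 * ‖R‖ + 1, by positivity, hTle, fun v => ?_, abs_det_appendMap ?_ ?_⟩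
  · have hker : v - R (L v) ∈ K := by simp [K, hR]
    have h1 : ‖v‖ ≤ ‖v - R (L v)‖ + ‖R (L v)‖ := by
      simpa using norm_add_le (v - R (L v)) (R (L v))
    have h2 : ‖T (v - R (L v))‖ ≤ ‖T v‖ + ‖T (R (L v))‖ := by
      rw [map_sub]
      exact norm_sub_le _ _
    have h3 := hTeq _ hker
    have h4 := hTle (R (L v))
    have h5 := R.le_opNorm (L v)
    nlinarith [norm_nonneg (L v)]
  · ext i j
    have h : inner ℝ (b j) (b i) = if j = i then (1 : ℝ) else 0 :=
      orthonormal_iff_ite.1 b.orthonormal j i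
    rw [Submodule.coe_inner, PiLp.inner_apply] at h
    simpa [Matrix.mul_apply, hTmat, Matrix.one_apply, eq_comm] using h
  · ext i j
    have hb : L (b j) = 0 := (b j).2
    have h := apply_eq_sum_euclideanMatrix L (b j) i
    rw [hb] at h
    simpa [Matrix.mul_apply, hTmat, Matrix.mulVec, dotProduct] using h.symm

theorem isAddHaarMeasure_hausdorffMeasure_euclidean (k : ℕ) :
    (μH[(k : ℝ)] : Measure (EuclideanSpace ℝ (Fin k))).IsAddHaarMeasure := by
  simpa using isAddHaarMeasure_hausdorffMeasure (E := EuclideanSpace ℝ (Fin k))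

/-- The ratio between the product of Lebesgue and Hausdorff measure on `ℝᴺ × ℝᵏ` and Lebesgue
measure on `ℝᴺ⁺ᵏ`. -/
noncomputable def coareaConst (N k : ℕ) : NNReal :=
  Measure.addHaarScalarFactor
    (((volume : Measure (EuclideanSpace ℝ (Fin N))).prod
      (μH[(k : ℝ)] : Measure (EuclideanSpace ℝ (Fin k)))).map (euclideanAppend N k)) volume

theorem coareaConst_pos (N k : ℕ) : 0 < coareaConst N k := by
  have := isAddHaarMeasure_hausdorffMeasure_euclidean k
  have := (euclideanAppend N k).isAddHaarMeasure_map
    ((volume : Measure (EuclideanSpace ℝ (Fin N))).prod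
      (μH[(k : ℝ)] : Measure (EuclideanSpace ℝ (Fin k))))
  exact Measure.addHaarScalarFactor_pos_of_isAddHaarMeasure _ _

theorem prod_hausdorffMeasure_apply {N k : ℕ}
    (S : Set (EuclideanSpace ℝ (Fin N) × EuclideanSpace ℝ (Fin k))) :
    ((volume : Measure (EuclideanSpace ℝ (Fin N))).prod
      (μH[(k : ℝ)] : Measure (EuclideanSpace ℝ (Fin k)))) S =
      coareaConst N k * volume (euclideanAppend N k '' S) := by
  have := isAddHaarMeasure_hausdorffMeasure_euclidean k
  have := (euclideanAppend N k).isAddHaarMeasure_map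
    ((volume : Measure (EuclideanSpace ℝ (Fin N))).prod
      (μH[(k : ℝ)] : Measure (EuclideanSpace ℝ (Fin k))))
  have h := Measure.isAddLeftInvariant_eq_smul
    (((volume : Measure (EuclideanSpace ℝ (Fin N))).prod
      (μH[(k : ℝ)] : Measure (EuclideanSpace ℝ (Fin k)))).map (euclideanAppend N k)) volume
  have h' := congrArg (fun μ => μ (euclideanAppend N k '' S)) h
  have he := (euclideanAppend N k).toHomeomorph.measurableEmbedding
  have hmap := he.map_apply ((volume : Measure (EuclideanSpace ℝ (Fin N))).prod
      (μH[(k : ℝ)] : Measure (EuclideanSpace ℝ (Fin k)))) (euclideanAppend N k '' S)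
  simp only [ContinuousLinearEquiv.coe_toHomeomorph] at hmap
  rw [Set.preimage_image_eq _ (euclideanAppend N k).injective] at hmap
  rw [← hmap]
  exact h'.trans (Measure.coe_nnreal_smul_apply _ _ _)

/-- The co-area formula on `A`, up to a factor `κ`. -/
def HasCoareaEstimate {N k : ℕ} (κ : NNReal)
    (Φ : EuclideanSpace ℝ (Fin (N + k)) → EuclideanSpace ℝ (Fin N))
    (Φ' : EuclideanSpace ℝ (Fin (N + k)) →
      EuclideanSpace ℝ (Fin (N + k)) →L[ℝ] EuclideanSpace ℝ (Fin N))
    (A : Set (EuclideanSpace ℝ (Fin (N + k)))) : Prop :=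
  ∃ f : EuclideanSpace ℝ (Fin N) → ENNReal, Measurable f ∧
    (∀ y, f y ≤ μH[(k : ℝ)] (A ∩ Φ ⁻¹' {y})) ∧
    (∀ y, μH[(k : ℝ)] (A ∩ Φ ⁻¹' {y}) ≤ (κ : ENNReal) ^ k * f y) ∧
    (∫⁻ y, f y ≤ κ * (coareaConst N k * ∫⁻ x in A, ENNReal.ofReal (coareaFactor (Φ' x)))) ∧
    (coareaConst N k * ∫⁻ x in A, ENNReal.ofReal (coareaFactor (Φ' x)) ≤ κ * ∫⁻ y, f y)

theorem exists_nhds_coareaFactor_le {N k : ℕ} {κ : NNReal} (hκ : 1 < κ)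
    {L : EuclideanSpace ℝ (Fin (N + k)) →L[ℝ] EuclideanSpace ℝ (Fin N)}
    (hL : 0 < coareaFactor L)
    {T : EuclideanSpace ℝ (Fin (N + k)) →L[ℝ] EuclideanSpace ℝ (Fin k)}
    (hT : |(appendMap L T).det| = coareaFactor L) :
    ∃ δ : ℝ, 0 < δ ∧ ∀ L' : EuclideanSpace ℝ (Fin (N + k)) →L[ℝ] EuclideanSpace ℝ (Fin N),
      ‖appendMap L' T - appendMap L T‖ < δ →
      coareaFactor L' ≤ κ * |(appendMap L' T).det| ∧
      |(appendMap L' T).det| ≤ κ * coareaFactor L' := by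
  let pr : EuclideanSpace ℝ (Fin (N + k)) →L[ℝ] EuclideanSpace ℝ (Fin N) :=
    (ContinuousLinearMap.fst ℝ _ (EuclideanSpace ℝ (Fin k))).comp
      ((euclideanAppend N k).symm : _ →L[ℝ] _)
  have hpr : ∀ L', pr.comp (appendMap L' T) = L' := fun L' => by
    ext1 v
    simp [pr, appendMap]
  have hκ' : (1 : ℝ) < κ := by exact_mod_cast hκ
  have hdet : Continuous fun S : EuclideanSpace ℝ (Fin (N + k)) →L[ℝ]
      EuclideanSpace ℝ (Fin (N + k)) => |S.det| :=
    continuous_abs.comp ContinuousLinearMap.continuous_det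
  have hfac : Continuous fun S : EuclideanSpace ℝ (Fin (N + k)) →L[ℝ]
      EuclideanSpace ℝ (Fin (N + k)) => coareaFactor (pr.comp S) :=
    continuous_coareaFactor.comp (by fun_prop)
  have h1 : ∀ᶠ S in nhds (appendMap L T), coareaFactor (pr.comp S) < κ * |S.det| := by
    refine hfac.continuousAt.eventually_lt (hdet.const_mul (κ : ℝ)).continuousAt ?_
    rw [hpr, hT]
    nlinarith
  have h2 : ∀ᶠ S in nhds (appendMap L T), |S.det| < κ * coareaFactor (pr.comp S) := by
    refine hdet.continuousAt.eventually_lt (hfac.const_mul (κ : ℝ)).continuousAt ?_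
    rw [hpr, hT]
    nlinarith
  obtain ⟨δ, hδ, H⟩ := Metric.eventually_nhds_iff.1 (h1.and h2)
  refine ⟨δ, hδ, fun L' hL' => ?_⟩
  have h := H (y := appendMap L' T) (by rwa [dist_eq_norm])
  rw [hpr] at h
  exact ⟨h.1.le, h.2.le⟩

theorem preimage_mk_image_prod {X Y Z : Type*} (Φ : X → Y) (T : X → Z) (A : Set X) (y : Y) :
    Prod.mk y ⁻¹' ((fun x => (Φ x, T x)) '' A) = T '' (A ∩ Φ ⁻¹' {y}) := by
  ext z
  simp only [Set.mem_preimage, Set.mem_image, Prod.mk.injEq, Set.mem_inter_iff,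
    Set.mem_singleton_iff]
  exact ⟨fun ⟨x, hx, h1, h2⟩ => ⟨x, ⟨hx, h1⟩, h2⟩, fun ⟨x, ⟨hx, h1⟩, h2⟩ => ⟨x, hx, h1, h2⟩⟩

theorem hausdorffMeasure_le_of_norm_sub_le {E F : Type*} [NormedAddCommGroup E]
    [MeasurableSpace E] [BorelSpace E] [NormedAddCommGroup F] [MeasurableSpace F] [BorelSpace F]
    {g : E → F} {κ : NNReal} {s : Set E} {d : ℝ} (hd : 0 ≤ d)
    (h : ∀ x ∈ s, ∀ x' ∈ s, ‖x - x'‖ ≤ κ * ‖g x - g x'‖) :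
    μH[d] s ≤ (κ : ENNReal) ^ d * μH[d] (g '' s) := by
  rcases s.eq_empty_or_nonempty with rfl | ⟨x₀, -⟩
  · simp
  have : Nonempty E := ⟨x₀⟩
  have hinj : Set.InjOn g s := fun x hx x' hx' hxx' => by
    have := h x hx x' hx'
    rw [hxx', sub_self, norm_zero, mul_zero] at this
    exact sub_eq_zero.1 (norm_le_zero_iff.1 this)
  have hlip : LipschitzOnWith κ (Function.invFunOn g s) (g '' s) := by
    refine LipschitzOnWith.of_dist_le_mul ?_
    rintro _ ⟨x, hx, rfl⟩ _ ⟨x', hx', rfl⟩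
    rw [hinj.leftInvOn_invFunOn hx, hinj.leftInvOn_invFunOn hx', dist_eq_norm, dist_eq_norm]
    exact h x hx x' hx'
  simpa [hinj.invFunOn_image subset_rfl] using hlip.hausdorffMeasure_image_le hd

theorem exists_hasCoareaEstimate_of_approximatesLinearOn {N k : ℕ} {κ : NNReal} (hκ : 1 < κ)
    {L : EuclideanSpace ℝ (Fin (N + k)) →L[ℝ] EuclideanSpace ℝ (Fin N)}
    (hL : 0 < coareaFactor L) :
    ∃ r : NNReal, r ≠ 0 ∧
      ∀ (Φ : EuclideanSpace ℝ (Fin (N + k)) → EuclideanSpace ℝ (Fin N))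
        (Φ' : EuclideanSpace ℝ (Fin (N + k)) →
          EuclideanSpace ℝ (Fin (N + k)) →L[ℝ] EuclideanSpace ℝ (Fin N))
        (A : Set (EuclideanSpace ℝ (Fin (N + k)))), MeasurableSet A →
        (∀ x ∈ A, HasFDerivWithinAt Φ (Φ' x) A x) →
        ApproximatesLinearOn Φ L A r → HasCoareaEstimate κ Φ Φ' A := by
  have hHaar := isAddHaarMeasure_hausdorffMeasure_euclidean k
  obtain ⟨T, C, hC, hT1, hTC, hTdet⟩ := exists_kernel_coordinates hL
  obtain ⟨δ, hδ, hδL⟩ := exists_nhds_coareaFactor_le hκ hL hTdet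
  have hκ' : (1 : ℝ) < κ := by exact_mod_cast hκ
  let e : (EuclideanSpace ℝ (Fin N) × EuclideanSpace ℝ (Fin k)) →L[ℝ]
    EuclideanSpace ℝ (Fin (N + k)) := euclideanAppend N k
  obtain ⟨r, hr0, hr⟩ : ∃ r : ℝ, 0 < r ∧ (κ * C * r ≤ κ - 1 ∧ (‖e‖ + 1) * r < δ) := by
    refine ⟨min ((κ - 1) / (κ * C)) (δ / (2 * (‖e‖ + 1))), ?_, ?_, ?_⟩
    · have : (0 : ℝ) < κ - 1 := by linarith
      positivity
    · calc κ * C * min ((κ - 1) / (κ * C)) (δ / (2 * (‖e‖ + 1)))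
          ≤ κ * C * ((κ - 1) / (κ * C)) := by gcongr; exact min_le_left _ _
        _ = κ - 1 := by field_simp
    · calc (‖e‖ + 1) * min ((κ - 1) / (κ * C)) (δ / (2 * (‖e‖ + 1)))
          ≤ (‖e‖ + 1) * (δ / (2 * (‖e‖ + 1))) := by gcongr; exact min_le_right _ _
        _ = δ / 2 := by field_simp
        _ < δ := by linarith
  lift r to NNReal using hr0.le
  refine ⟨r, fun h => hr0.ne' (congrArg NNReal.toReal h), ?_⟩
  intro Φ Φ' A hA hΦ' hΦL
  have hfib : ∀ x ∈ A, ∀ x' ∈ A, Φ x = Φ x' → ‖x - x'‖ ≤ κ * ‖T x - T x'‖ := by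
    intro x hx x' hx' hxx'
    have h1 := hΦL x hx x' hx'
    rw [hxx', sub_self, zero_sub, norm_neg] at h1
    have h2 := hTC (x - x')
    rw [map_sub T] at h2
    have h3 : ‖L (x - x')‖ ≤ r * ‖x - x'‖ := h1
    have h4 : κ * ‖x - x'‖ ≤ κ * ‖T x - T x'‖ + κ * C * r * ‖x - x'‖ := by
      have := mul_le_mul_of_nonneg_left h3 hC.le
      have := mul_le_mul_of_nonneg_left (h2.trans (by linarith)) κ.2 (c := ‖T x - T x'‖ +
        C * (r * ‖x - x'‖))
      simp only [NNReal.val_eq_coe] at this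
      linarith
    nlinarith [norm_nonneg (x - x')]
  have hcont : ContinuousOn (fun x => (Φ x, T x)) A := fun x hx =>
    (hΦ' x hx).continuousWithinAt.prodMk T.continuous.continuousWithinAt
  have hinj : Set.InjOn (fun x => (Φ x, T x)) A := by
    intro x hx x' hx' hxx'
    have h := hfib x hx x' hx' (congrArg Prod.fst hxx')
    rw [show T x = T x' from congrArg Prod.snd hxx', sub_self, norm_zero, mul_zero] at h
    exact sub_eq_zero.1 (norm_le_zero_iff.1 h)
  have hS : MeasurableSet ((fun x => (Φ x, T x)) '' A) := hA.image_of_continuousOn_injOn hcont hinj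
  have hΨ' : ∀ x ∈ A, HasFDerivWithinAt (fun x => euclideanAppend N k (Φ x, T x))
      (appendMap (Φ' x) T) A x := fun x hx =>
    e.hasFDerivAt.comp_hasFDerivWithinAt x ((hΦ' x hx).prodMk T.hasFDerivWithinAt)
  have hΨL : ApproximatesLinearOn (fun x => euclideanAppend N k (Φ x, T x)) (appendMap L T) A
      (‖e‖₊ * r) := by
    intro x hx x' hx'
    have heq : euclideanAppend N k (Φ x, T x) - euclideanAppend N k (Φ x', T x') -
        appendMap L T (x - x') = e (Φ x - Φ x' - L (x - x'), 0) := by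
      simp [appendMap, e, ← map_sub]
    rw [heq]
    refine (e.le_opNorm _).trans ?_
    have h := hΦL x hx x' hx'
    rw [NNReal.coe_mul, mul_assoc, coe_nnnorm]
    gcongr
    simpa [Prod.norm_def] using h
  have hdet : ∀ᵐ x ∂(volume.restrict A), coareaFactor (Φ' x) ≤ κ * |(appendMap (Φ' x) T).det| ∧
      |(appendMap (Φ' x) T).det| ≤ κ * coareaFactor (Φ' x) := by
    filter_upwards [hΨL.norm_fderiv_sub_le volume hA (fun x => appendMap (Φ' x) T) hΨ'] with x hx
    refine hδL _ (lt_of_le_of_lt (show _ ≤ ‖e‖ * r from hx) ?_)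
    nlinarith
  have hvol : ∫⁻ y, μH[(k : ℝ)] (Prod.mk y ⁻¹' ((fun x => (Φ x, T x)) '' A)) =
      coareaConst N k * ∫⁻ x in A, ENNReal.ofReal |(appendMap (Φ' x) T).det| := by
    rw [← Measure.prod_apply hS, prod_hausdorffMeasure_apply, Set.image_image,
      lintegral_abs_det_fderiv_eq_addHaar_image volume hA hΨ'
        ((euclideanAppend N k).injective.comp_injOn hinj)]
  have hstep : ∀ g g' : EuclideanSpace ℝ (Fin (N + k)) → ℝ,
      (∀ᵐ x ∂(volume.restrict A), g x ≤ κ * g' x) →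
      (coareaConst N k : ENNReal) * ∫⁻ x in A, ENNReal.ofReal (g x) ≤
        κ * (coareaConst N k * ∫⁻ x in A, ENNReal.ofReal (g' x)) := by
    intro g g' h
    rw [mul_left_comm (κ : ENNReal), ← lintegral_const_mul' (κ : ENNReal) _ ENNReal.coe_ne_top]
    refine mul_le_mul_right (lintegral_mono_ae (h.mono fun x hx => ?_)) _
    rw [← ENNReal.ofReal_coe_nnreal, ← ENNReal.ofReal_mul κ.coe_nonneg]
    exact ENNReal.ofReal_le_ofReal hx
  refine ⟨fun y => μH[(k : ℝ)] (Prod.mk y ⁻¹' ((fun x => (Φ x, T x)) '' A)),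
    measurable_measure_prodMk_left hS, fun y => ?_, fun y => ?_, ?_, ?_⟩
  · simp only [preimage_mk_image_prod]
    have hlip : LipschitzWith 1 T := LipschitzWith.of_dist_le_mul fun x x' => by
      simpa [dist_eq_norm] using hT1 (x - x')
    simpa using hlip.hausdorffMeasure_image_le k.cast_nonneg (A ∩ Φ ⁻¹' {y})
  · simp only [preimage_mk_image_prod]
    have h := hausdorffMeasure_le_of_norm_sub_le (g := T) (κ := κ) (s := A ∩ Φ ⁻¹' {y})
      (Nat.cast_nonneg k) fun x hx x' hx' => hfib x hx.1 x' hx'.1 (hx.2.trans hx'.2.symm)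
    simpa using h
  · rw [hvol]
    exact hstep _ _ (hdet.mono fun x hx => hx.2)
  · rw [hvol]
    exact hstep _ _ (hdet.mono fun x hx => hx.1)

theorem hasCoareaEstimate {N k : ℕ} {κ : NNReal} (hκ : 1 < κ)
    {Φ : EuclideanSpace ℝ (Fin (N + k)) → EuclideanSpace ℝ (Fin N)}
    {Φ' : EuclideanSpace ℝ (Fin (N + k)) →
      EuclideanSpace ℝ (Fin (N + k)) →L[ℝ] EuclideanSpace ℝ (Fin N)}
    {A : Set (EuclideanSpace ℝ (Fin (N + k)))} (hA : MeasurableSet A)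
    (hΦ' : ∀ x ∈ A, HasFDerivWithinAt Φ (Φ' x) A x)
    (hpos : ∀ x ∈ A, 0 < coareaFactor (Φ' x)) : HasCoareaEstimate κ Φ Φ' A := by
  classical
  rcases A.eq_empty_or_nonempty with rfl | hne
  · exact ⟨0, measurable_zero, by simp, by simp, by simp, by simp⟩
  choose! r hr0 hr using fun (L : EuclideanSpace ℝ (Fin (N + k)) →L[ℝ] EuclideanSpace ℝ (Fin N))
    (hL : 0 < coareaFactor L) => exists_hasCoareaEstimate_of_approximatesLinearOn hκ hL
  obtain ⟨t, L, htd, htm, htA, htL, hL⟩ :=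
    exists_partition_approximatesLinearOn_of_hasFDerivWithinAt Φ A Φ' hΦ'
      (fun L => if 0 < coareaFactor L then r L else 1) fun L => by
        split_ifs with h
        exacts [hr0 L h, one_ne_zero]
  have hLpos : ∀ n, 0 < coareaFactor (L n) := fun n => by
    obtain ⟨y, hy, h⟩ := hL hne n
    rw [h]
    exact hpos y hy
  have hm : ∀ n, MeasurableSet (A ∩ t n) := fun n => hA.inter (htm n)
  have hd : Pairwise (Function.onFun Disjoint fun n => A ∩ t n) := fun i j hij =>
    (htd hij).mono Set.inter_subset_right Set.inter_subset_right
  have hU : A = ⋃ n, A ∩ t n := by rw [← Set.inter_iUnion, Set.inter_eq_left.2 htA]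
  have hest : ∀ n, HasCoareaEstimate κ Φ Φ' (A ∩ t n) := fun n => by
    refine hr (L n) (hLpos n) Φ Φ' _ (hm n)
      (fun x hx => (hΦ' x hx.1).mono Set.inter_subset_left) ?_
    simpa [hLpos n] using htL n
  choose f hf h1 h2 h3 h4 using hest
  have hfib : ∀ y, μH[(k : ℝ)] (A ∩ Φ ⁻¹' {y}) = ∑' n, μH[(k : ℝ)] (A ∩ t n ∩ Φ ⁻¹' {y}) := by
    intro y
    rw [← Measure.restrict_apply hA]
    conv_lhs => rw [hU]
    rw [measure_iUnion hd hm]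
    exact tsum_congr fun n => Measure.restrict_apply (hm n)
  have hint : ∫⁻ x in A, ENNReal.ofReal (coareaFactor (Φ' x)) =
      ∑' n, ∫⁻ x in A ∩ t n, ENNReal.ofReal (coareaFactor (Φ' x)) := by
    conv_lhs => rw [hU]
    exact lintegral_iUnion hm hd _
  refine ⟨fun y => ∑' n, f n y, Measurable.tsum hf, fun y => ?_, fun y => ?_, ?_, ?_⟩
  · rw [hfib]
    exact ENNReal.tsum_le_tsum fun n => h1 n y
  · rw [hfib, ← ENNReal.tsum_mul_left]
    exact ENNReal.tsum_le_tsum fun n => h2 n y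
  · rw [hint, lintegral_tsum fun n => (hf n).aemeasurable, ← ENNReal.tsum_mul_left,
      ← ENNReal.tsum_mul_left]
    exact ENNReal.tsum_le_tsum h3
  · rw [hint, lintegral_tsum fun n => (hf n).aemeasurable, ← ENNReal.tsum_mul_left,
      ← ENNReal.tsum_mul_left]
    exact ENNReal.tsum_le_tsum h4

theorem ENNReal.le_of_forall_one_lt_le_pow_mul {a b : ENNReal} (n : ℕ)
    (h : ∀ κ : NNReal, 1 < κ → a ≤ (κ : ENNReal) ^ n * b) : a ≤ b := by
  have hlim : Filter.Tendsto (fun κ : NNReal => (κ : ENNReal) ^ n * b)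
      (nhdsWithin 1 (Set.Ioi 1)) (nhds b) := by
    have h1 : Filter.Tendsto (fun κ : NNReal => (κ : ENNReal) ^ n) (nhdsWithin 1 (Set.Ioi 1))
        (nhds 1) := by
      have : Continuous fun κ : NNReal => (κ : ENNReal) ^ n :=
        (ENNReal.continuous_pow n).comp ENNReal.continuous_coe
      simpa using (this.tendsto 1).mono_left nhdsWithin_le_nhds
    simpa using ENNReal.Tendsto.mul_const (b := b) h1 (Or.inl one_ne_zero)
  exact ge_of_tendsto hlim (Filter.eventually_of_mem self_mem_nhdsWithin h)

/-- The co-area formula for sets on which the derivative has full rank. -/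
theorem coarea_formula_set {N k : ℕ}
    {Φ : EuclideanSpace ℝ (Fin (N + k)) → EuclideanSpace ℝ (Fin N)}
    {Φ' : EuclideanSpace ℝ (Fin (N + k)) →
      EuclideanSpace ℝ (Fin (N + k)) →L[ℝ] EuclideanSpace ℝ (Fin N)}
    {A : Set (EuclideanSpace ℝ (Fin (N + k)))} (hA : MeasurableSet A)
    (hΦ' : ∀ x ∈ A, HasFDerivWithinAt Φ (Φ' x) A x)
    (hpos : ∀ x ∈ A, 0 < coareaFactor (Φ' x)) :
    (Measurable fun y => μH[(k : ℝ)] (A ∩ Φ ⁻¹' {y})) ∧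
      ∫⁻ y, μH[(k : ℝ)] (A ∩ Φ ⁻¹' {y}) =
        coareaConst N k * ∫⁻ x in A, ENNReal.ofReal (coareaFactor (Φ' x)) := by
  have hest := fun (κ : NNReal) (hκ : 1 < κ) => hasCoareaEstimate hκ hA hΦ' hpos
  choose! f hf h1 h2 h3 h4 using hest
  obtain ⟨u, -, hu1, hu⟩ := exists_seq_strictAnti_tendsto (1 : NNReal)
  have hsup : (fun y => μH[(k : ℝ)] (A ∩ Φ ⁻¹' {y})) = fun y => ⨆ n, f (u n) y := by
    ext y
    refine le_antisymm ?_ (iSup_le fun n => h1 _ (hu1 n) y)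
    have hlim : Filter.Tendsto (fun n => (u n : ENNReal) ^ k * ⨆ n, f (u n) y) Filter.atTop
        (nhds (1 * ⨆ n, f (u n) y)) := by
      refine ENNReal.Tendsto.mul_const ?_ (Or.inl one_ne_zero)
      have : Continuous fun κ : NNReal => (κ : ENNReal) ^ k :=
        (ENNReal.continuous_pow k).comp ENNReal.continuous_coe
      simpa [Function.comp_def] using (this.tendsto 1).comp hu
    rw [one_mul] at hlim
    refine ge_of_tendsto' hlim fun n => (h2 _ (hu1 n) y).trans ?_
    gcongr
    exact le_iSup (fun n => f (u n) y) n
  have hmeas : Measurable fun y => μH[(k : ℝ)] (A ∩ Φ ⁻¹' {y}) := by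
    rw [hsup]
    exact Measurable.iSup fun n => hf _ (hu1 n)
  refine ⟨hmeas, le_antisymm ?_ ?_⟩
  · refine ENNReal.le_of_forall_one_lt_le_pow_mul (k + 1) fun κ hκ => ?_
    calc ∫⁻ y, μH[(k : ℝ)] (A ∩ Φ ⁻¹' {y}) ≤ ∫⁻ y, (κ : ENNReal) ^ k * f κ y :=
          lintegral_mono (h2 κ hκ)
      _ = (κ : ENNReal) ^ k * ∫⁻ y, f κ y := lintegral_const_mul _ (hf κ hκ)
      _ ≤ (κ : ENNReal) ^ k * (κ * (coareaConst N k *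
            ∫⁻ x in A, ENNReal.ofReal (coareaFactor (Φ' x)))) := by
          gcongr
          exact h3 κ hκ
      _ = _ := by ring
  · refine ENNReal.le_of_forall_one_lt_le_pow_mul 1 fun κ hκ => (h4 κ hκ).trans ?_
    rw [pow_one]
    gcongr with y
    exact h1 κ hκ y

/-- The co-area formula for functions on a set where the derivative has full rank. -/
theorem coarea_formula_lintegral {N k : ℕ}
    {Φ : EuclideanSpace ℝ (Fin (N + k)) → EuclideanSpace ℝ (Fin N)}
    {Φ' : EuclideanSpace ℝ (Fin (N + k)) →
      EuclideanSpace ℝ (Fin (N + k)) →L[ℝ] EuclideanSpace ℝ (Fin N)}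
    {A : Set (EuclideanSpace ℝ (Fin (N + k)))} (hA : MeasurableSet A)
    (hΦ' : ∀ x ∈ A, HasFDerivWithinAt Φ (Φ' x) A x)
    (hpos : ∀ x ∈ A, 0 < coareaFactor (Φ' x))
    (hJ : Measurable fun x => coareaFactor (Φ' x))
    {g : EuclideanSpace ℝ (Fin (N + k)) → ENNReal} (hg : Measurable g) :
    (Measurable fun y => ∫⁻ x in A ∩ Φ ⁻¹' {y}, g x ∂μH[(k : ℝ)]) ∧
      ∫⁻ y, ∫⁻ x in A ∩ Φ ⁻¹' {y}, g x ∂μH[(k : ℝ)] =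
        coareaConst N k * ∫⁻ x in A, g x * ENNReal.ofReal (coareaFactor (Φ' x)) := by
  have hJ' : Measurable fun x => ENNReal.ofReal (coareaFactor (Φ' x)) := hJ.ennreal_ofReal
  refine Measurable.ennreal_induction
    (motive := fun g => (Measurable fun y => ∫⁻ x in A ∩ Φ ⁻¹' {y}, g x ∂μH[(k : ℝ)]) ∧
      ∫⁻ y, ∫⁻ x in A ∩ Φ ⁻¹' {y}, g x ∂μH[(k : ℝ)] =
        coareaConst N k * ∫⁻ x in A, g x * ENNReal.ofReal (coareaFactor (Φ' x))) ?_ ?_ ?_ hg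
  · intro c s hs
    obtain ⟨h1, h2⟩ := coarea_formula_set (A := s ∩ A) (hs.inter hA)
      (fun x hx => (hΦ' x hx.2).mono Set.inter_subset_right) fun x hx => hpos x hx.2
    have heq : ∀ y, ∫⁻ x in A ∩ Φ ⁻¹' {y}, s.indicator (fun _ => c) x ∂μH[(k : ℝ)] =
        c * μH[(k : ℝ)] (s ∩ A ∩ Φ ⁻¹' {y}) := fun y => by
      rw [lintegral_indicator_const hs, Measure.restrict_apply hs, Set.inter_assoc]
    simp only [heq]
    refine ⟨h1.const_mul c, ?_⟩
    rw [lintegral_const_mul _ h1, h2, mul_left_comm, ← lintegral_const_mul _ hJ',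
      ← Measure.restrict_restrict hs, ← lintegral_indicator hs]
    congr 2 with x
    by_cases hx : x ∈ s <;> simp [hx]
  · intro f g _ hf hg ihf ihg
    have hfJ : Measurable fun x => f x * ENNReal.ofReal (coareaFactor (Φ' x)) := hf.mul hJ'
    simp only [Pi.add_apply, lintegral_add_left hf, add_mul]
    refine ⟨ihf.1.add ihg.1, ?_⟩
    rw [lintegral_add_left ihf.1, ihf.2, ihg.2, lintegral_add_left hfJ, mul_add]
  · intro f hf hmono ih
    have hfJ : ∀ n, Measurable fun x => f n x * ENNReal.ofReal (coareaFactor (Φ' x)) :=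
      fun n => (hf n).mul hJ'
    have hmonoJ : Monotone fun n x => f n x * ENNReal.ofReal (coareaFactor (Φ' x)) :=
      fun i j hij x => mul_le_mul_left (hmono hij x) _
    simp only [lintegral_iSup hf hmono, ENNReal.iSup_mul]
    refine ⟨Measurable.iSup fun n => (ih n).1, ?_⟩
    rw [lintegral_iSup (fun n => (ih n).1) fun i j hij y => lintegral_mono (hmono hij),
      lintegral_iSup hfJ hmonoJ, ENNReal.mul_iSup]
    simp only [(ih _).2]

theorem differentiableAt_of_coareaFactor_pos {M N : ℕ}
    {Φ : EuclideanSpace ℝ (Fin M) → EuclideanSpace ℝ (Fin N)} {x : EuclideanSpace ℝ (Fin M)}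
    (h : 0 < coareaFactor (fderiv ℝ Φ x)) : DifferentiableAt ℝ Φ x := by
  rcases Nat.eq_zero_or_pos N with rfl | hN
  · rw [Subsingleton.elim Φ fun _ => 0]
    exact differentiableAt_const 0
  · by_contra hd
    have : Nonempty (Fin N) := ⟨⟨0, hN⟩⟩
    have hz : euclideanMatrix (0 : EuclideanSpace ℝ (Fin M) →L[ℝ] EuclideanSpace ℝ (Fin N)) = 0 :=
      rfl
    rw [fderiv_zero_of_not_differentiableAt hd, coareaFactor, hz, Matrix.zero_mul,
      Matrix.det_zero, Real.sqrt_zero] at h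
    exact h.false

/-- Integrals over the fibres of `Φ` of the density `p / J`, for an arbitrary Lebesgue measurable
`p` supported where the co-area factor is positive. -/
theorem exists_fiber_integral {N k : ℕ}
    {Φ : EuclideanSpace ℝ (Fin (N + k)) → EuclideanSpace ℝ (Fin N)} (hΦ : Continuous Φ)
    {p : EuclideanSpace ℝ (Fin (N + k)) → ℝ} (hp : AEMeasurable p) (hp0 : ∀ x, 0 ≤ p x)
    (hpos : ∀ x, 0 < p x → 0 < coareaFactor (fderiv ℝ Φ x))
    {F : Set (EuclideanSpace ℝ (Fin (N + k)))} (hF : MeasurableSet F) :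
    ∃ G : EuclideanSpace ℝ (Fin N) → ENNReal, Measurable G ∧
      (∀ᵐ y, ∫⁻ x in Φ ⁻¹' {y} ∩ F, ENNReal.ofReal (p x / coareaFactor (fderiv ℝ Φ x))
        ∂μH[(k : ℝ)] = G y) ∧
      ∀ w : EuclideanSpace ℝ (Fin N) → ENNReal, Measurable w →
        ∫⁻ y, w y * G y = coareaConst N k * ∫⁻ x in F, w (Φ x) * ENNReal.ofReal (p x) := by
  have hJ : Measurable fun x => coareaFactor (fderiv ℝ Φ x) :=
    continuous_coareaFactor.measurable.comp (measurable_fderiv ℝ Φ)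
  set R := {x | 0 < coareaFactor (fderiv ℝ Φ x)}
  have hR : MeasurableSet R := measurableSet_lt measurable_const hJ
  have hΦ' : ∀ A ⊆ R, ∀ x ∈ A, HasFDerivWithinAt Φ (fderiv ℝ Φ x) A x := fun A hA x hx =>
    (differentiableAt_of_coareaFactor_pos (hA hx)).hasFDerivAt.hasFDerivWithinAt
  let q := hp.mk p
  have hq : Measurable q := hp.measurable_mk
  let Z := toMeasurable volume {x | ¬ p x = q x}
  have hZ : MeasurableSet Z := measurableSet_toMeasurable _ _
  have hZ0 : volume Z = 0 := by rw [measure_toMeasurable]; exact hp.ae_eq_mk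
  have hpq : ∀ x, x ∉ Z → p x = q x := fun x hx => by
    by_contra h
    exact hx (subset_toMeasurable _ _ h)
  have hpR : ∀ x, x ∉ R → p x = 0 := fun x hx =>
    le_antisymm (not_lt.1 fun h => hx (hpos x h)) (hp0 x)
  let g := fun x => ENNReal.ofReal (q x / coareaFactor (fderiv ℝ Φ x))
  have hg : Measurable g := (hq.div hJ).ennreal_ofReal
  have hgF : Measurable (F.indicator g) := hg.indicator hF
  have hcoarea := fun (f : EuclideanSpace ℝ (Fin (N + k)) → ENNReal) (hf : Measurable f) =>
    coarea_formula_lintegral hR (hΦ' R subset_rfl) (fun x hx => hx) hJ hf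
  refine ⟨_, (hcoarea _ hgF).1, ?_, fun w hw => ?_⟩
  · obtain ⟨h1, h2⟩ := coarea_formula_set (hZ.inter hR)
      (hΦ' _ Set.inter_subset_right) fun x hx => hx.2
    rw [setLIntegral_measure_zero _ _ (measure_mono_null Set.inter_subset_left hZ0), mul_zero,
      lintegral_eq_zero_iff h1] at h2
    filter_upwards [h2] with y hy
    have hind : (fun x => ENNReal.ofReal (p x / coareaFactor (fderiv ℝ Φ x))) =
        R.indicator fun x => ENNReal.ofReal (p x / coareaFactor (fderiv ℝ Φ x)) := by
      ext x
      by_cases hx : x ∈ R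
      · simp [hx]
      · simp [hx, hpR x hx]
    rw [hind, lintegral_indicator hR, Measure.restrict_restrict hR, lintegral_indicator hF,
      Measure.restrict_restrict hF, Set.inter_comm F, Set.inter_assoc]
    refine lintegral_congr_ae ?_
    have hZae : ∀ᵐ x ∂(μH[(k : ℝ)].restrict (R ∩ (Φ ⁻¹' {y} ∩ F))), x ∉ Z := by
      rw [ae_iff]
      simp only [not_not, Set.ofPred_mem_eq]
      rw [Measure.restrict_apply hZ]
      refine measure_mono_null ?_ hy
      exact fun x hx => ⟨⟨hx.1, hx.2.1⟩, hx.2.2.1⟩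
    filter_upwards [hZae] with x hx
    simp only [g, hpq x hx]
  · have hm : Measurable fun x => w (Φ x) * F.indicator g x := (hw.comp hΦ.measurable).mul hgF
    have hfib : ∀ y, ∫⁻ x in R ∩ Φ ⁻¹' {y}, w (Φ x) * F.indicator g x ∂μH[(k : ℝ)] =
        w y * ∫⁻ x in R ∩ Φ ⁻¹' {y}, F.indicator g x ∂μH[(k : ℝ)] := fun y => by
      rw [← lintegral_const_mul _ hgF]
      refine setLIntegral_congr_fun
        (hR.inter (hΦ.measurable (measurableSet_singleton y))) fun x hx => ?_
      simp only [show Φ x = y from hx.2]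
    simp only [← hfib]
    rw [(hcoarea _ hm).2, ← lintegral_indicator hR, ← lintegral_indicator hF]
    congr 1
    refine lintegral_congr_ae ?_
    filter_upwards [hp.ae_eq_mk] with x hx
    by_cases hxR : x ∈ R
    · by_cases hxF : x ∈ F
      · have hxJ : 0 < coareaFactor (fderiv ℝ Φ x) := hxR
        have hxq : p x = q x := hx
        simp only [hxR, hxF, Set.indicator_of_mem, g]
        rw [mul_assoc, ← ENNReal.ofReal_mul' hxJ.le, div_mul_cancel₀ _ hxJ.ne', hxq]
      · simp [hxF]
    · by_cases hxF : x ∈ F <;> simp [hxR, hxF, hpR x hxR]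

/-- With `Φ : ℝᴹ → ℝᴺ` Lipschitz, `M > N`, density `p` with `J_NΦ > 0` on `{p > 0}`,
marginal `m(y)`, and `Q(y,F) = m(y)⁻¹ ∫_{Φ⁻¹(y)∩F} p/J_NΦ dH^{M−N}` (a point mass `δ_{x*}`
when `m(y) ∉ (0,∞)`), the kernel `P(x,F) = Q(Φ(x),F)` is a regular conditional probability
for `p·λᴹ` given `Φ⁻¹(B)`: for every `C ∈ Φ⁻¹(B)` and Lebesgue measurable `F`,
`P(C ∩ F) = ∫_C P(x,F) P(dx)`. -/
theorem regular_conditional_probability_coarea (M N : ℕ) (hMN : N < M)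
    (Φ : EuclideanSpace ℝ (Fin M) → EuclideanSpace ℝ (Fin N))
    (hΦ : ∃ c : NNReal, LipschitzWith c Φ)
    (p : EuclideanSpace ℝ (Fin M) → ℝ) (hp0 : ∀ x, 0 ≤ p x)
    (hp1 : ∫ x, p x = 1)
    (J : EuclideanSpace ℝ (Fin M) → ℝ)
    (hJ : ∀ x, J x = Real.sqrt
      ((Matrix.of (fun (i : Fin N) (j : Fin M) =>
        fderiv ℝ Φ x (EuclideanSpace.single j 1) i) *
       (Matrix.of (fun (i : Fin N) (j : Fin M) =>
        fderiv ℝ Φ x (EuclideanSpace.single j 1) i)).transpose).det))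
    (hJpos : ∀ x, 0 < p x → 0 < J x)
    (m : EuclideanSpace ℝ (Fin N) → ENNReal)
    (hm : ∀ y, m y = ∫⁻ x in Φ ⁻¹' {y}, ENNReal.ofReal (p x / J x)
      ∂(MeasureTheory.Measure.hausdorffMeasure ((M : ℝ) - N)))
    (xstar : EuclideanSpace ℝ (Fin M))
    (Q : EuclideanSpace ℝ (Fin N) → Set (EuclideanSpace ℝ (Fin M)) → ENNReal)
    (hQ : ∀ y F, Q y F =
      if 0 < m y ∧ m y < ⊤ then
        (m y)⁻¹ * ∫⁻ x in Φ ⁻¹' {y} ∩ F, ENNReal.ofReal (p x / J x)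
          ∂(MeasureTheory.Measure.hausdorffMeasure ((M : ℝ) - N))
      else F.indicator (fun _ => 1) xstar) :
    ∀ (D : Set (EuclideanSpace ℝ (Fin N))) (F : Set (EuclideanSpace ℝ (Fin M))),
      MeasurableSet D → MeasurableSet F →
      ∫⁻ x in (Φ ⁻¹' D) ∩ F, ENNReal.ofReal (p x) =
        ∫⁻ x in Φ ⁻¹' D, Q (Φ x) F * ENNReal.ofReal (p x) := by
  obtain ⟨k, rfl⟩ := Nat.exists_eq_add_of_le hMN.le
  obtain ⟨c, hc⟩ := hΦ
  have hΦ := hc.continuous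
  obtain rfl : J = fun x => coareaFactor (fderiv ℝ Φ x) := funext hJ
  have hk : ((N + k : ℕ) : ℝ) - N = k := by push_cast; ring
  rw [hk] at hm hQ
  intro D F hD hF
  have hint : Integrable p := by
    by_contra h
    rw [integral_undef h] at hp1
    exact zero_ne_one hp1
  have hp : AEMeasurable p := hint.aemeasurable
  obtain ⟨G, hG, hGF, hGw⟩ := exists_fiber_integral hΦ hp hp0 hJpos hF
  obtain ⟨G₁, hG₁, hGm, hG₁w⟩ := exists_fiber_integral hΦ hp hp0 hJpos MeasurableSet.univ
  simp only [Measure.restrict_univ, Set.inter_univ, ← hm] at hGm hG₁w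
  have hc0 : (coareaConst N k : ENNReal) ≠ 0 := by exact_mod_cast (coareaConst_pos N k).ne'
  have hGle : ∀ᵐ y, G y ≤ G₁ y := by
    filter_upwards [hGF, hGm] with y h1 h2
    rw [← h1, ← h2, hm]
    exact lintegral_mono_set Set.inter_subset_left
  have htop : ∀ᵐ y, G₁ y < ⊤ := by
    refine ae_lt_top hG₁ ?_
    have h := hG₁w (fun _ => 1) measurable_const
    simp only [one_mul] at h
    rw [h]
    exact ENNReal.mul_ne_top ENNReal.coe_ne_top hint.lintegral_lt_top.ne
  have hgood : ∀ᵐ y, G₁ y ≠ 0 → Q y F = (G₁ y)⁻¹ * G y := by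
    filter_upwards [hGF, hGm, htop] with y h1 h2 h3 h4
    rw [hQ, h2, if_pos ⟨pos_iff_ne_zero.2 h4, h3⟩, h1]
  have hQae : ∀ᵐ x, Q (Φ x) F * ENNReal.ofReal (p x) =
      (G₁ (Φ x))⁻¹ * G (Φ x) * ENNReal.ofReal (p x) := by
    let B := {y | G₁ y = 0} ∪
      toMeasurable volume {y | ¬ (G₁ y ≠ 0 → Q y F = (G₁ y)⁻¹ * G y)}
    have hB : MeasurableSet B :=
      (hG₁ (measurableSet_singleton 0)).union (measurableSet_toMeasurable _ _)
    have hw : Measurable (B.indicator fun _ => (1 : ENNReal)) := measurable_const.indicator hB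
    have h0 : ∫⁻ y, B.indicator (fun _ => 1) y * G₁ y = 0 := by
      refine (lintegral_eq_zero_iff (hw.mul hG₁)).2 ?_
      have hnull : ∀ᵐ y, y ∉ toMeasurable volume
          {y | ¬ (G₁ y ≠ 0 → Q y F = (G₁ y)⁻¹ * G y)} := by
        rw [ae_iff]
        simp only [not_not, Set.ofPred_mem_eq]
        rw [measure_toMeasurable]
        exact hgood
      filter_upwards [hnull] with y hy
      by_cases hy0 : G₁ y = 0
      · simp [hy0]
      · have : y ∉ B := fun h => h.elim hy0 hy
        simp [this]
    rw [hG₁w _ hw, mul_eq_zero, or_iff_right hc0] at h0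
    filter_upwards [(lintegral_eq_zero_iff'
      ((hw.comp hΦ.measurable).aemeasurable.mul hp.ennreal_ofReal)).1 h0] with x hx
    by_cases hxB : Φ x ∈ B
    · have hx' : B.indicator (fun _ => (1 : ENNReal)) (Φ x) * ENNReal.ofReal (p x) = 0 := hx
      rw [Set.indicator_of_mem hxB, one_mul] at hx'
      rw [hx', mul_zero, mul_zero]
    · have h1 : G₁ (Φ x) ≠ 0 := fun h => hxB (Or.inl h)
      have h2 : G₁ (Φ x) ≠ 0 → Q (Φ x) F = (G₁ (Φ x))⁻¹ * G (Φ x) := by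
        by_contra h
        exact hxB (Or.inr (subset_toMeasurable _ _ h))
      rw [h2 h1]
  have hΦD : MeasurableSet (Φ ⁻¹' D) := hΦ.measurable hD
  have hleft := hGw (D.indicator fun _ => 1) (measurable_const.indicator hD)
  have hright := hG₁w (D.indicator fun y => (G₁ y)⁻¹ * G y) ((hG₁.inv.mul hG).indicator hD)
  have hL : ∫⁻ x in Φ ⁻¹' D ∩ F, ENNReal.ofReal (p x) =
      ∫⁻ x in F, D.indicator (fun _ => 1) (Φ x) * ENNReal.ofReal (p x) := by
    rw [← Measure.restrict_restrict hΦD, ← lintegral_indicator hΦD]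
    congr 1 with x
    by_cases hx : Φ x ∈ D <;> simp [Set.indicator, hx]
  have hR : ∫⁻ x in Φ ⁻¹' D, Q (Φ x) F * ENNReal.ofReal (p x) =
      ∫⁻ x, D.indicator (fun y => (G₁ y)⁻¹ * G y) (Φ x) * ENNReal.ofReal (p x) := by
    rw [lintegral_congr_ae (ae_restrict_of_ae hQae), ← lintegral_indicator hΦD]
    congr 1 with x
    by_cases hx : Φ x ∈ D <;> simp [Set.indicator, hx]
  rw [hL, hR, ← ENNReal.mul_right_inj hc0 ENNReal.coe_ne_top, ← hleft, ← hright]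
  refine lintegral_congr_ae ?_
  filter_upwards [hGle, htop] with y h1 h2
  by_cases hy : y ∈ D
  · simp only [Set.indicator_of_mem hy, one_mul]
    by_cases h0 : G₁ y = 0
    · rw [h0, mul_zero]
      exact le_antisymm (h0 ▸ h1) zero_le
    · rw [mul_right_comm, ENNReal.inv_mul_cancel h0 h2.ne, one_mul]
  · simp [hy]
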